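/- arXiv:2511.06543 — 2 statements merged into one kernel-verified Lean document; each statement's English description precedes it below -/
import Mathlib

section
/- Let K be a compact subset of the unit circle of arclength measure 0, U an open subset of ℂ containing K, and ε > 0. Then there exists h continuous on the closed unit disc and holomorphic on its interior such that: (a) |h(z)| < ε for all z in the closed disc outside U; (b) h(z) = 1 for all z ∈ K; (c) Re(h(z)) ≥ 0 for all z in the closed disc; and (d) |Im(h(z))| < ε for all z in the closed disc. -/
open Complex Metric MeasureTheory Filter Set

noncomputable section

/-- A finite Blaschke product: a unimodular constant times a finite product of
disc automorphisms `z ↦ (z - wₖ)/(1 - conj wₖ · z)` with `wₖ` in the open unit disc. -/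
def IsFiniteBlaschke (B : ℂ → ℂ) : Prop :=
  ∃ (n : ℕ) (ζ : ℂ) (w : Fin (n + 1) → ℂ),
    ‖ζ‖ = 1 ∧ (∀ k, ‖w k‖ < 1) ∧
    ∀ z : ℂ, B z = ζ * ∏ k, (z - w k) / (1 - (starRingEnd ℂ) (w k) * z)

/-- Arclength measure on the unit circle, viewed as a measure on `ℂ`. -/
def arclength : Measure ℂ :=
  Measure.map (circleMap 0 1) (volume.restrict (Set.Ioc 0 (2 * Real.pi)))

/-- A set of vanishing one-dimensional Hausdorff measure is covered by countably many balls,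
centred at points of the set, whose radii have arbitrarily small sum. -/
theorem exists_ball_cover_of_hausdorffMeasure_one_eq_zero {X : Type*} [MetricSpace X]
    [MeasurableSpace X] [BorelSpace X] {K : Set X} (hne : K.Nonempty)
    (hK : Measure.hausdorffMeasure 1 K = 0) {δ : ENNReal} (hδ : δ ≠ 0) :
    ∃ (w : ℕ → X) (r : ℕ → NNReal), (∀ n, w n ∈ K) ∧ (∀ n, 0 < r n) ∧
      ∑' n, (r n : ENNReal) < δ ∧ ∀ z ∈ K, ∃ n, dist z (w n) < r n := by
  classical
  obtain ⟨x₀, hx₀⟩ := hne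
  rw [Measure.hausdorffMeasure_apply] at hK
  have hδ2 : δ / 2 ≠ 0 := by simp [hδ]
  obtain ⟨e, he0, he⟩ := ENNReal.exists_pos_sum_of_countable hδ2 ℕ
  have hinf := lt_of_le_of_lt (le_iSup₂ (f := fun (r : ENNReal) (_ : 0 < r) =>
        ⨅ (t : ℕ → Set X) (_ : K ⊆ ⋃ n, t n) (_ : ∀ n, ediam (t n) ≤ r),
          ∑' n, ⨆ _ : (t n).Nonempty, ediam (t n) ^ (1 : ℝ)) 1 one_pos)
    (hK.trans_lt (pos_iff_ne_zero.2 hδ2))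
  simp only [iInf_lt_iff] at hinf
  obtain ⟨t, htK, htd, ht⟩ := hinf
  have htop : ∀ n, ediam (t n) ≠ ⊤ := fun n => ((htd n).trans_lt ENNReal.one_lt_top).ne
  have hw : ∀ n, ∃ w ∈ K, (t n ∩ K).Nonempty → w ∈ t n := by
    intro n
    by_cases h : (t n ∩ K).Nonempty
    · exact ⟨h.some, h.some_mem.2, fun _ => h.some_mem.1⟩
    · exact ⟨x₀, hx₀, fun h' => absurd h' h⟩
  choose w hwK hwt using hw
  refine ⟨w, fun n => (ediam (t n)).toNNReal + e n, hwK, fun n => by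
    have := he0 n; positivity, ?_, ?_⟩
  · calc ∑' n, (((ediam (t n)).toNNReal + e n : NNReal) : ENNReal)
        = ∑' n, (ediam (t n) + e n) := by
          congr 1; ext n; rw [ENNReal.coe_add, ENNReal.coe_toNNReal (htop n)]
      _ = ∑' n, ediam (t n) + ∑' n, (e n : ENNReal) := ENNReal.tsum_add
      _ ≤ (∑' n, ⨆ _ : (t n).Nonempty, ediam (t n) ^ (1 : ℝ)) + ∑' n, (e n : ENNReal) := by
          gcongr with n
          rcases (t n).eq_empty_or_nonempty with h | h
          · simp [h]
          · simp [h]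
      _ < δ / 2 + δ / 2 := ENNReal.add_lt_add ht he
      _ = δ := ENNReal.add_halves δ
  · intro z hz
    obtain ⟨n, hn⟩ := mem_iUnion.1 (htK hz)
    refine ⟨n, ?_⟩
    have h1 : edist z (w n) ≤ ediam (t n) := edist_le_ediam_of_mem hn (hwt n ⟨z, hn, hz⟩)
    have h2 : dist z (w n) ≤ (ediam (t n)).toReal := by
      rw [dist_edist]; exact ENNReal.toReal_mono (htop n) h1
    have := he0 n
    calc dist z (w n) ≤ (ediam (t n)).toReal := h2
      _ < (ediam (t n)).toReal + e n := by simpa using this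
      _ = _ := by simp [ENNReal.coe_toNNReal_eq_toReal]

/-- Infinitely many ball covers as in `exists_ball_cover_of_hausdorffMeasure_one_eq_zero`,
with small total sum of radii. -/
theorem exists_seq_ball_cover_of_hausdorffMeasure_one_eq_zero {X : Type*} [MetricSpace X]
    [MeasurableSpace X] [BorelSpace X] {K : Set X} (hne : K.Nonempty)
    (hK : Measure.hausdorffMeasure 1 K = 0) {δ : ℝ} (hδ : 0 < δ) :
    ∃ (w : ℕ × ℕ → X) (r : ℕ × ℕ → ℝ), (∀ i, w i ∈ K) ∧ (∀ i, 0 < r i) ∧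
      Summable r ∧ ∑' i, r i ≤ δ ∧ ∀ z ∈ K, ∀ m, ∃ n, dist z (w (m, n)) < r (m, n) := by
  obtain ⟨e, he0, he⟩ := ENNReal.exists_pos_sum_of_countable'
    (ENNReal.ofReal_pos.2 hδ).ne' ℕ
  choose w r hw hr hsum hcov using fun m =>
    exists_ball_cover_of_hausdorffMeasure_one_eq_zero hne hK (he0 m).ne'
  have hs : ∑' i : ℕ × ℕ, (r i.1 i.2 : ENNReal) ≤ ENNReal.ofReal δ := by
    rw [ENNReal.tsum_prod (f := fun m n => (r m n : ENNReal))]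
    exact (ENNReal.tsum_le_tsum fun m => (hsum m).le).trans he.le
  have hne_top := (hs.trans_lt ENNReal.ofReal_lt_top).ne
  refine ⟨fun i => w i.1 i.2, fun i => r i.1 i.2, fun i => hw _ _, fun i => hr _ _,
    ?_, ?_, fun z hz m => hcov m z hz⟩
  · exact NNReal.summable_coe.2 (ENNReal.tsum_coe_ne_top_iff_summable.1 hne_top)
  · have := ENNReal.toReal_mono ENNReal.ofReal_ne_top hs
    rwa [ENNReal.tsum_toReal_eq (by simp), ENNReal.toReal_ofReal hδ.le] at this

/-- A subset of the unit circle of arclength zero is `μH[1]`-null. -/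
theorem hausdorffMeasure_one_eq_zero_of_arclength_eq_zero {K : Set ℂ} (hK : MeasurableSet K)
    (hKs : K ⊆ sphere (0 : ℂ) 1) (hK0 : arclength K = 0) :
    Measure.hausdorffMeasure 1 K = 0 := by
  have hm : Measurable (circleMap 0 1) := (continuous_circleMap 0 1).measurable
  rw [arclength, Measure.map_apply hm hK, Measure.restrict_apply (hm hK),
    ← hausdorffMeasure_real] at hK0
  have hle := (lipschitzWith_circleMap 0 1).hausdorffMeasure_image_le zero_le_one
    (circleMap 0 1 ⁻¹' K ∩ Ioc 0 (2 * Real.pi))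
  rw [hK0, mul_zero] at hle
  refine measure_mono_null ?_ (le_antisymm hle zero_le)
  intro z hz
  have hz' := hKs hz
  rw [← abs_one (α := ℝ), ← image_circleMap_Ioc] at hz'
  obtain ⟨θ, hθ, rfl⟩ := hz'
  exact ⟨θ, ⟨hz, hθ⟩, rfl⟩

/-- The denominator of `peakKernel`. -/
def peakDenom (w : ℂ) (r : ℝ) (z : ℂ) : ℂ := 1 + r - (starRingEnd ℂ) w * z

/-- A function with positive real part on the closed unit disc which has real part at least `1/4`
at distance at most `r` from the point `w` of the unit circle. -/
def peakKernel (w : ℂ) (r : ℝ) (z : ℂ) : ℂ := r / peakDenom w r z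

section peakKernel

variable {w z : ℂ} {r : ℝ}

theorem norm_one_sub_conj_mul (hw : ‖w‖ = 1) : ‖1 - (starRingEnd ℂ) w * z‖ = ‖z - w‖ := by
  have h : (1 : ℂ) - (starRingEnd ℂ) w * z = (starRingEnd ℂ) w * (w - z) := by
    rw [mul_sub, Complex.conj_mul', hw]; simp
  rw [h, norm_mul, RCLike.norm_conj, hw, one_mul, norm_sub_rev]

theorem le_re_peakDenom (hw : ‖w‖ = 1) : r + (1 - ‖z‖) ≤ (peakDenom w r z).re := by
  have h : ((starRingEnd ℂ) w * z).re ≤ ‖z‖ := by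
    refine (Complex.re_le_norm _).trans ?_
    rw [norm_mul, RCLike.norm_conj, hw, one_mul]
  simp only [peakDenom, sub_re, add_re, one_re, ofReal_re]
  linarith

theorem le_norm_peakDenom (hw : ‖w‖ = 1) : r + (1 - ‖z‖) ≤ ‖peakDenom w r z‖ :=
  (le_re_peakDenom hw).trans (Complex.re_le_norm _)

theorem norm_peakDenom_le (hw : ‖w‖ = 1) (hr : 0 < r) :
    ‖peakDenom w r z‖ ≤ ‖z - w‖ + r := by
  have h : peakDenom w r z = (1 - (starRingEnd ℂ) w * z) + r := by simp only [peakDenom]; ring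
  rw [h]
  refine (norm_add_le _ _).trans ?_
  rw [norm_one_sub_conj_mul hw, Complex.norm_of_nonneg hr.le]

theorem norm_sub_le_norm_peakDenom (hw : ‖w‖ = 1) (hr : 0 < r) :
    ‖z - w‖ ≤ ‖peakDenom w r z‖ + r := by
  have h : 1 - (starRingEnd ℂ) w * z = peakDenom w r z - r := by simp only [peakDenom]; ring
  rw [← norm_one_sub_conj_mul hw, h]
  refine (norm_sub_le _ _).trans ?_
  rw [Complex.norm_of_nonneg hr.le]

theorem peakDenom_ne_zero (hw : ‖w‖ = 1) (hr : 0 < r) (hz : ‖z‖ ≤ 1) :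
    peakDenom w r z ≠ 0 := by
  have := le_norm_peakDenom (r := r) (z := z) hw
  exact norm_pos_iff.1 (by linarith)

theorem norm_peakKernel_le_of_le_norm_sub (hw : ‖w‖ = 1) (hr : 0 < r) (hz : ‖z‖ ≤ 1) {d : ℝ}
    (hd : 0 < d) (h : d ≤ ‖z - w‖) : ‖peakKernel w r z‖ ≤ r * (2 / d) := by
  have h1 := le_norm_peakDenom (r := r) (z := z) hw
  have h2 := norm_sub_le_norm_peakDenom (z := z) hw hr
  rw [peakKernel, norm_div, Complex.norm_of_nonneg hr.le, div_le_iff₀ (by linarith),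
    mul_assoc]
  refine le_mul_of_one_le_right hr.le ?_
  rw [div_mul_eq_mul_div, one_le_div hd]
  linarith

theorem norm_peakKernel_le_of_norm_le (hw : ‖w‖ = 1) (hr : 0 < r) {ρ : ℝ}
    (hρ : ρ < 1) (hz : ‖z‖ ≤ ρ) : ‖peakKernel w r z‖ ≤ r * (1 - ρ)⁻¹ := by
  have h1 := le_norm_peakDenom (r := r) (z := z) hw
  rw [peakKernel, norm_div, Complex.norm_of_nonneg hr.le, div_eq_mul_inv]
  have : 0 < 1 - ρ := by linarith
  gcongr
  linarith

theorem re_peakKernel : (peakKernel w r z).re =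
    r * ((peakDenom w r z).re / Complex.normSq (peakDenom w r z)) := by
  rw [peakKernel, div_eq_mul_inv, Complex.re_ofReal_mul, Complex.inv_re]

theorem re_peakKernel_nonneg (hw : ‖w‖ = 1) (hr : 0 < r) (hz : ‖z‖ ≤ 1) :
    0 ≤ (peakKernel w r z).re := by
  have h1 := le_re_peakDenom (r := r) (z := z) hw
  rw [re_peakKernel]
  exact mul_nonneg hr.le (div_nonneg (by linarith) (Complex.normSq_nonneg _))

theorem quarter_le_re_peakKernel (hw : ‖w‖ = 1) (hr : 0 < r) (hz : ‖z‖ ≤ 1)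
    (h : ‖z - w‖ ≤ r) : 1 / 4 ≤ (peakKernel w r z).re := by
  have h1 := le_re_peakDenom (r := r) (z := z) hw
  have h2 := norm_peakDenom_le (z := z) hw hr
  have h3 := Complex.normSq_pos.2 (peakDenom_ne_zero hw hr hz)
  have h4 : Complex.normSq (peakDenom w r z) ≤ (2 * r) ^ 2 := by
    rw [Complex.normSq_eq_norm_sq]
    gcongr
    linarith
  rw [re_peakKernel, ← mul_div_assoc, le_div_iff₀ h3]
  nlinarith

theorem differentiableAt_peakKernel (hw : ‖w‖ = 1) (hr : 0 < r) (hz : ‖z‖ ≤ 1) :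
    DifferentiableAt ℂ (peakKernel w r) z := by
  have h : DifferentiableAt ℂ (peakDenom w r) z := by unfold peakDenom; fun_prop
  exact (differentiableAt_const _).div h (peakDenom_ne_zero hw hr hz)

end peakKernel

/-- A closed null subset `K` of the circle carries a holomorphic function on the disc with
nonnegative real part which is small away from `K` and whose real part tends to `∞` at `K`. -/
theorem exists_re_nonneg_tendsto_atTop {K : Set ℂ} (hKc : IsCompact K)
    (hne : K.Nonempty) (hKs : K ⊆ sphere (0 : ℂ) 1) (hK : Measure.hausdorffMeasure 1 K = 0)
    {d η : ℝ} (hd : 0 < d) (hη : 0 < η) :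
    ∃ F : ℂ → ℂ, ContinuousOn F (closedBall 0 1 \ K) ∧ DifferentiableOn ℂ F (ball 0 1) ∧
      (∀ z ∈ closedBall (0 : ℂ) 1 \ K, 0 ≤ (F z).re) ∧
      (∀ z ∈ closedBall (0 : ℂ) 1, (∀ w ∈ K, d ≤ dist z w) → ‖F z‖ ≤ η) ∧
      ∀ z₀ ∈ K, Tendsto (fun z => (F z).re) (nhdsWithin z₀ (closedBall 0 1 \ K)) atTop := by
  obtain ⟨w, r, hw, hr, hrs, hrδ, hcov⟩ := exists_seq_ball_cover_of_hausdorffMeasure_one_eq_zero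
    hne hK (δ := η * d / 2) (by positivity)
  have hw1 : ∀ i, ‖w i‖ = 1 := fun i => by simpa using hKs (hw i)
  have hbound : ∀ {e : ℝ} {z : ℂ}, 0 < e → ‖z‖ ≤ 1 → (∀ v ∈ K, e ≤ dist z v) →
      ∀ i, ‖peakKernel (w i) (r i) z‖ ≤ r i * (2 / e) := fun he hz h i =>
    norm_peakKernel_le_of_le_norm_sub (hw1 i) (hr i) hz he (by
      simpa [dist_eq_norm] using h (w i) (hw i))
  have hsep : ∀ {z : ℂ}, ∀ v ∈ K, infDist z K ≤ dist z v := fun v hv => infDist_le_dist_of_mem hv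
  have hpos : ∀ {z : ℂ}, z ∉ K → 0 < infDist z K := fun hz =>
    (hKc.isClosed.notMem_iff_infDist_pos hne).1 hz
  have hsum : ∀ z ∈ closedBall (0 : ℂ) 1 \ K,
      Summable fun i => peakKernel (w i) (r i) z := fun z hz =>
    .of_norm_bounded (hrs.mul_right _)
      (hbound (hpos hz.2) (by simpa using hz.1) hsep)
  refine ⟨fun z => ∑' i, peakKernel (w i) (r i) z, ?_, ?_, ?_, ?_, ?_⟩
  · intro z₀ hz₀
    have he := half_pos (hpos hz₀.2)
    set e := infDist z₀ K / 2 with he_def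
    have hcont : ContinuousOn (fun z => ∑' i, peakKernel (w i) (r i) z)
        (closedBall 0 1 ∩ {z | e < infDist z K}) := by
      refine continuousOn_tsum (fun i z hz => ?_) (hrs.mul_right (2 / e)) fun i z hz => ?_
      · exact (differentiableAt_peakKernel (hw1 i) (hr i)
          (by simpa using hz.1)).continuousAt.continuousWithinAt
      · exact hbound he (by simpa using hz.1) (fun v hv => hz.2.le.trans (hsep v hv)) i
    refine (hcont z₀ ⟨hz₀.1, by simp only [mem_ofPred_eq]; linarith⟩).mono_of_mem_nhdsWithin ?_
    refine inter_mem (mem_of_superset self_mem_nhdsWithin sdiff_subset)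
      (mem_nhdsWithin_of_mem_nhds ?_)
    exact (isOpen_lt continuous_const (continuous_infDist_pt K)).mem_nhds
      (by simp only [mem_ofPred_eq]; linarith)
  · intro z₀ hz₀
    obtain ⟨ρ, hρ, hρ1⟩ := exists_between (mem_ball_zero_iff.1 hz₀)
    have hdiff : DifferentiableOn ℂ (fun z => ∑' i, peakKernel (w i) (r i) z) (ball 0 ρ) := by
      refine Complex.differentiableOn_tsum_of_summable_norm (hrs.mul_right (1 - ρ)⁻¹)
        (fun i z hz => ?_) isOpen_ball fun i z hz => ?_
      · exact (differentiableAt_peakKernel (hw1 i) (hr i)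
          ((mem_ball_zero_iff.1 hz).trans hρ1).le).differentiableWithinAt
      · exact norm_peakKernel_le_of_norm_le (hw1 i) (hr i) hρ1 (mem_ball_zero_iff.1 hz).le
    exact (hdiff.differentiableAt
      (isOpen_ball.mem_nhds (mem_ball_zero_iff.2 hρ))).differentiableWithinAt
  · intro z hz
    rw [Complex.re_tsum (hsum z hz)]
    exact tsum_nonneg fun i => re_peakKernel_nonneg (hw1 i) (hr i) (by simpa using hz.1)
  · intro z hz h
    refine (tsum_of_norm_bounded (hrs.mul_right (2 / d)).hasSum
      (hbound hd (by simpa using hz) h)).trans ?_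
    rw [tsum_mul_right, ← mul_div_assoc, div_le_iff₀ hd]
    linarith
  · intro z₀ hz₀
    refine tendsto_atTop.2 fun b => ?_
    obtain ⟨N, hN⟩ := exists_nat_ge (4 * b)
    choose n hn using fun m => hcov z₀ hz₀ m
    have hnear : ∀ᶠ z in nhdsWithin z₀ (closedBall 0 1 \ K), ∀ m ∈ Finset.range N,
        dist z (w (m, n m)) < r (m, n m) := by
      refine (Filter.eventually_all_finset _).2 fun m _ => mem_nhdsWithin_of_mem_nhds ?_
      exact isOpen_ball.mem_nhds (hn m)
    filter_upwards [hnear, self_mem_nhdsWithin] with z hz hzK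
    have hz1 : ‖z‖ ≤ 1 := by simpa using hzK.1
    have hre := Complex.hasSum_re (hsum z hzK).hasSum
    have hinj : Function.Injective fun m : ℕ => (m, n m) := fun a b h => congrArg Prod.fst h
    calc b ≤ N * (1 / 4 : ℝ) := by linarith
      _ = ∑ m ∈ Finset.range N, (1 / 4 : ℝ) := by simp
      _ ≤ ∑ m ∈ Finset.range N, (peakKernel (w (m, n m)) (r (m, n m)) z).re :=
          Finset.sum_le_sum fun m hm => quarter_le_re_peakKernel (hw1 _) (hr _) hz1
            (by simpa [dist_eq_norm] using (hz m hm).le)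
      _ = ∑ i ∈ (Finset.range N).map ⟨_, hinj⟩, (peakKernel (w i) (r i) z).re := by
          rw [Finset.sum_map]; rfl
      _ ≤ _ := sum_le_hasSum _
          (fun i _ => re_peakKernel_nonneg (hw1 i) (hr i) hz1) hre

/-- A closed null subset of the circle is a peak set of the disc algebra, with a peak function
`Q` of positive real part, bounded by `2` and small away from `K`. -/
theorem exists_peak_function_re_pos {K : Set ℂ} (hKc : IsCompact K)
    (hne : K.Nonempty) (hKs : K ⊆ sphere (0 : ℂ) 1) (hK : Measure.hausdorffMeasure 1 K = 0)
    {d η : ℝ} (hd : 0 < d) (hη : 0 < η) :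
    ∃ Q : ℂ → ℂ, ContinuousOn Q (closedBall 0 1) ∧ DifferentiableOn ℂ Q (ball 0 1) ∧
      (∀ z ∈ closedBall (0 : ℂ) 1, 0 < (Q z).re) ∧
      (∀ z ∈ closedBall (0 : ℂ) 1, ‖Q z‖ ≤ 2) ∧
      (∀ z ∈ K, Q z = 1) ∧
      ∀ z ∈ closedBall (0 : ℂ) 1, (∀ w ∈ K, d ≤ dist z w) → ‖Q z‖ ≤ η := by
  classical
  obtain ⟨F, hFc, hFd, hF0, hFs, hFK⟩ :=
    exists_re_nonneg_tendsto_atTop hKc hne hKs hK hd (half_pos hη)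
  set D : ℂ → ℂ := fun z => 1 + (η / 2 : ℝ) + F z with hD
  have hDre : ∀ z, (D z).re = 1 + η / 2 + (F z).re := fun z => by
    simp only [hD, add_re, one_re, ofReal_re]
  have hDnorm : ∀ z ∈ closedBall (0 : ℂ) 1 \ K, 1 + η / 2 ≤ ‖D z‖ := fun z hz => by
    have := hF0 z hz
    refine le_trans ?_ (Complex.re_le_norm _)
    rw [hDre]; linarith
  have hD0 : ∀ z ∈ closedBall (0 : ℂ) 1 \ K, D z ≠ 0 := fun z hz =>
    norm_pos_iff.1 (by linarith [hDnorm z hz])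
  set G : ℂ → ℂ := fun z => if z ∈ K then 0 else (D z)⁻¹ with hG
  have hGK : ∀ z ∈ K, G z = 0 := fun z hz => if_pos hz
  have hGD : ∀ z ∉ K, G z = (D z)⁻¹ := fun z hz => if_neg hz
  have hGnorm : ∀ z ∈ closedBall (0 : ℂ) 1, ‖G z‖ < 1 := fun z hz => by
    by_cases hzK : z ∈ K
    · simp [hGK z hzK]
    · rw [hGD z hzK, norm_inv]
      exact inv_lt_one_of_one_lt₀ (by linarith [hDnorm z ⟨hz, hzK⟩])
  have hballK : ball (0 : ℂ) 1 ⊆ closedBall 0 1 \ K := fun z hz =>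
    ⟨ball_subset_closedBall hz, fun h =>
      (mem_ball_zero_iff.1 hz).ne (mem_sphere_zero_iff_norm.1 (hKs h))⟩
  have hGcont : ContinuousOn G (closedBall 0 1) := by
    have hunion : closedBall (0 : ℂ) 1 ⊆ K ∪ (closedBall 0 1 \ K) := by
      rw [union_sdiff_self]; exact subset_union_right
    intro z hz
    refine ContinuousWithinAt.mono ?_ hunion
    by_cases hzK : z ∈ K
    · refine ContinuousWithinAt.union ?_ ?_
      · exact continuousWithinAt_const.congr (fun y hy => hGK y hy) (hGK z hzK)
      · rw [ContinuousWithinAt, hGK z hzK]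
        have h : Tendsto (fun y => (D y)⁻¹) (nhdsWithin z (closedBall 0 1 \ K)) (nhds 0) := by
          refine tendsto_inv₀_cobounded.comp (tendsto_norm_atTop_iff_cobounded.1 ?_)
          refine tendsto_atTop_mono (fun y => ?_) (hFK z hzK)
          refine le_trans ?_ (Complex.re_le_norm _)
          rw [hDre]; linarith
        refine h.congr' ?_
        filter_upwards [self_mem_nhdsWithin] with y hy using (hGD y hy.2).symm
    · refine ContinuousWithinAt.union ?_ ?_
      · exact continuousWithinAt_of_notMem_closure (by rwa [hKc.isClosed.closure_eq])
      · refine ContinuousWithinAt.congr ?_ (fun y hy => hGD y hy.2) (hGD z hzK)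
        exact (continuousWithinAt_const.add (hFc z ⟨hz, hzK⟩)).inv₀ (hD0 z ⟨hz, hzK⟩)
  refine ⟨fun z => 1 - G z, continuousOn_const.sub hGcont, ?_, ?_, ?_, ?_, ?_⟩
  · have h : DifferentiableOn ℂ (fun z => 1 - (D z)⁻¹) (ball 0 1) :=
      (differentiableOn_const _).sub
        (((differentiableOn_const _).add hFd).inv fun z hz => hD0 z (hballK hz))
    exact h.congr fun z hz => by rw [hGD z (hballK hz).2]
  · intro z hz
    have := (Complex.re_le_norm (G z)).trans_lt (hGnorm z hz)
    simpa using this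
  · intro z hz
    refine (norm_sub_le _ _).trans ?_
    rw [norm_one]
    linarith [hGnorm z hz]
  · intro z hz
    simp [hGK z hz]
  · intro z hz h
    have hzK : z ∉ K := fun hzK => by simpa using hd.trans_le (h z hzK)
    have hD1 := hDnorm z ⟨hz, hzK⟩
    have hDz := hD0 z ⟨hz, hzK⟩
    have heq : 1 - G z = ((η / 2 : ℝ) + F z) / D z := by
      rw [hGD z hzK, eq_div_iff hDz, sub_mul, inv_mul_cancel₀ hDz, hD]
      ring
    change ‖1 - G z‖ ≤ η
    rw [heq, norm_div]
    refine (div_le_self (norm_nonneg _) (by linarith)).trans ?_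
    refine (norm_add_le _ _).trans ?_
    rw [Complex.norm_of_nonneg (by positivity)]
    linarith [hFs z hz h]

/-- A peak-function construction in the disc algebra: `h` is ≡ 1 on `K`, small off a
neighbourhood `U` of `K`, and takes values in a thin cone about the positive real axis. -/
theorem peak_function (K : Set ℂ) (hKc : IsCompact K) (hKs : K ⊆ Metric.sphere (0:ℂ) 1)
    (hK0 : arclength K = 0)
    (U : Set ℂ) (hU : IsOpen U) (hKU : K ⊆ U) (ε : ℝ) (hε : 0 < ε) :
    ∃ h : ℂ → ℂ, ContinuousOn h (Metric.closedBall (0:ℂ) 1) ∧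
      DifferentiableOn ℂ h (Metric.ball (0:ℂ) 1) ∧
      (∀ z ∈ Metric.closedBall (0:ℂ) 1 \ U, ‖h z‖ < ε) ∧
      (∀ z ∈ K, h z = 1) ∧
      (∀ z ∈ Metric.closedBall (0:ℂ) 1, 0 ≤ (h z).re) ∧
      (∀ z ∈ Metric.closedBall (0:ℂ) 1, |(h z).im| < ε) := by
  rcases K.eq_empty_or_nonempty with rfl | hne
  · exact ⟨fun _ => 0, continuousOn_const, differentiableOn_const _, by simp [hε], by simp,
      by simp, by simp [hε]⟩
  obtain ⟨d, hd, hdU⟩ := hKc.exists_thickening_subset_open hU hKU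
  obtain ⟨α, hα0, hα⟩ : ∃ α : ℝ, 0 < α ∧ α ≤ 1 ∧ 4 * α ≤ ε :=
    ⟨min 1 (ε / 4), by positivity, min_le_left _ _, by linarith [min_le_right 1 (ε / 4)]⟩
  obtain ⟨Q, hQc, hQd, hQre, hQ2, hQK, hQs⟩ := exists_peak_function_re_pos hKc hne hKs
    (hausdorffMeasure_one_eq_zero_of_arclength_eq_zero hKc.measurableSet hKs hK0) hd
    (Real.exp_pos (Real.log (ε / 2) / α))
  have hslit : ∀ z ∈ closedBall (0 : ℂ) 1, Q z ∈ slitPlane := fun z hz => Or.inl (hQre z hz)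
  have hQpos : ∀ z ∈ closedBall (0 : ℂ) 1, 0 < ‖Q z‖ := fun z hz =>
    (hQre z hz).trans_le (Complex.re_le_norm _)
  have hre : ∀ z, (α * log (Q z)).re = α * Real.log ‖Q z‖ := fun z => by
    rw [Complex.re_ofReal_mul, Complex.log_re]
  have him : ∀ z, (α * log (Q z)).im = α * arg (Q z) := fun z => by
    rw [Complex.im_ofReal_mul, Complex.log_im]
  have harg : ∀ z ∈ closedBall (0 : ℂ) 1, |α * arg (Q z)| ≤ α * (Real.pi / 2) := fun z hz => by
    rw [abs_mul, abs_of_pos hα0]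
    exact mul_le_mul_of_nonneg_left (Complex.abs_arg_le_pi_div_two_iff.2 (hQre z hz).le) hα0.le
  refine ⟨fun z => exp (α * log (Q z)), ?_, ?_, ?_, ?_, ?_, ?_⟩
  · exact (continuousOn_const.mul (hQc.clog hslit)).cexp
  · exact ((differentiableOn_const _).mul
      (hQd.clog fun z hz => hslit z (ball_subset_closedBall hz))).cexp
  · rintro z ⟨hz, hzU⟩
    have hfar : ∀ w ∈ K, d ≤ dist z w := fun w hw => by
      by_contra! h
      exact hzU (hdU (mem_thickening_iff.2 ⟨w, hw, h⟩))
    have hlog := Real.log_le_log (hQpos z hz) (hQs z hz hfar)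
    rw [Real.log_exp, le_div_iff₀ hα0] at hlog
    rw [Complex.norm_exp, hre]
    calc Real.exp (α * Real.log ‖Q z‖) ≤ Real.exp (Real.log (ε / 2)) :=
          Real.exp_le_exp.2 (by linarith)
      _ = ε / 2 := Real.exp_log (half_pos hε)
      _ < ε := half_lt_self hε
  · intro z hz
    simp [hQK z hz]
  · intro z hz
    rw [Complex.exp_re, him]
    have h := abs_le.1 ((harg z hz).trans (mul_le_of_le_one_left (by positivity) hα.1))
    exact mul_nonneg (Real.exp_pos _).le (Real.cos_nonneg_of_mem_Icc h)
  · intro z hz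
    have hexp : Real.exp (α * Real.log ‖Q z‖) ≤ 2 := by
      have h2 : Real.log ‖Q z‖ ≤ Real.log 2 := Real.log_le_log (hQpos z hz) (hQ2 z hz)
      have h3 : 0 ≤ Real.log 2 := Real.log_nonneg one_le_two
      calc Real.exp (α * Real.log ‖Q z‖) ≤ Real.exp (Real.log 2) :=
            Real.exp_le_exp.2 ((mul_le_mul_of_nonneg_left h2 hα0.le).trans
              (mul_le_of_le_one_left h3 hα.1))
        _ = 2 := Real.exp_log two_pos
    rw [Complex.exp_im, hre, him, abs_mul, abs_of_pos (Real.exp_pos _)]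
    calc Real.exp (α * Real.log ‖Q z‖) * |Real.sin (α * arg (Q z))|
        ≤ 2 * (α * (Real.pi / 2)) :=
          mul_le_mul hexp (Real.abs_sin_le_abs.trans (harg z hz)) (abs_nonneg _) two_pos.le
      _ < ε := by nlinarith [Real.pi_lt_four]
end
end

section
/- Let K be a compact subset of the unit circle of arclength measure 0, φ : K → ℂ continuous with sup_K |φ| ≤ 1, U an open subset of ℂ containing K, and ε > 0. Then there exists g continuous on the closed unit disc, holomorphic on its interior, with sup |g| ≤ 1 on the closed disc, such that sup_{z∈K} |g(z) − φ(z)| < ε and |g(z) − 1| < ε for all z in the closed disc outside U. -/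
open Complex Metric MeasureTheory Filter Set

noncomputable section

lemma exists_volume_eq_zero_image_circleMap {K : Set ℂ} (hKc : IsCompact K)
    (hKs : K ⊆ Metric.sphere (0:ℂ) 1) (hK0 : arclength K = 0) :
    ∃ T : Set ℝ, volume T = 0 ∧ circleMap 0 1 '' T = K := by
  refine ⟨circleMap 0 1 ⁻¹' K ∩ Set.Ioc 0 (2 * Real.pi), ?_, ?_⟩
  · rw [arclength, Measure.map_apply (measurable_circleMap 0 1) hKc.measurableSet,
      Measure.restrict_apply (measurable_circleMap 0 1 hKc.measurableSet)] at hK0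
    exact hK0
  · rw [Set.image_preimage_inter, image_circleMap_Ioc, abs_one]
    exact Set.inter_eq_left.2 hKs

/-- The image of a Lebesgue null subset of the line under a Lipschitz map contains no nontrivial
connected set. -/
lemma isTotallyDisconnected_image_of_volume_eq_zero {X : Type*} [MetricSpace X] {C : NNReal}
    {f : ℝ → X} (hf : LipschitzWith C f) {T : Set ℝ} (hT : volume T = 0) :
    IsTotallyDisconnected (f '' T) := by
  intro t ht hconn x hx y hy
  by_contra hxy
  have hlip : LipschitzWith (1 * C) ((fun z ↦ dist x z) ∘ f) :=
    (LipschitzWith.dist_right x).comp hf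
  have hnull : volume ((fun z ↦ dist x z) '' t) = 0 := by
    refine measure_mono_null (t := ((fun z ↦ dist x z) ∘ f) '' T) ?_ ?_
    · rw [Set.image_comp]
      exact Set.image_mono ht
    · have h := (hlip.lipschitzOnWith (s := T)).hausdorffMeasure_image_le zero_le_one
      rw [hausdorffMeasure_real, hT, mul_zero] at h
      exact nonpos_iff_eq_zero.1 h
  have hpre : IsPreconnected ((fun z ↦ dist x z) '' t) :=
    hconn.image _ (continuous_const.dist continuous_id).continuousOn
  have hsub : Set.Icc 0 (dist x y) ⊆ (fun z ↦ dist x z) '' t :=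
    hpre.Icc_subset ⟨x, hx, dist_self x⟩ ⟨y, hy, rfl⟩
  have h0 := measure_mono_null hsub hnull
  rw [Real.volume_Icc, ENNReal.ofReal_eq_zero, sub_zero] at h0
  exact (dist_pos.2 hxy).not_ge h0

/-- A compact set which is the image of a null set under a nonexpanding map has finite covers by
balls of arbitrarily small total radius. -/
lemma exists_finset_ball_cover_sum_le {X : Type*} [MetricSpace X] {f : ℝ → X}
    (hf : LipschitzWith 1 f) {T : Set ℝ} (hT : volume T = 0) (hc : IsCompact (f '' T))
    {η : ℝ} (hη : 0 < η) :
    ∃ (s : Finset ℝ) (r : ℝ → ℝ), (∀ θ ∈ s, 0 < r θ ∧ f θ ∈ f '' T) ∧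
      f '' T ⊆ ⋃ θ ∈ s, Metric.ball (f θ) (r θ) ∧ ∑ θ ∈ s, r θ ≤ η := by
  obtain ⟨t, r, -, htT, hr, hcov, hsum⟩ :=
    Besicovitch.exists_closedBall_covering_tsum_measure_le (volume : Measure ℝ)
      (ε := ENNReal.ofReal η) (by simpa using hη) (fun _ ↦ Set.Ioi 0) T
      (fun x _ δ hδ ↦ ⟨δ / 2, half_pos hδ, half_pos hδ, half_lt_self hδ⟩)
  have hopen : f '' T ⊆ ⋃ θ ∈ t, Metric.ball (f θ) (2 * r θ) := by
    rintro _ ⟨x, hx, rfl⟩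
    obtain ⟨θ, hθ, hxθ⟩ := Set.mem_iUnion₂.1 (hcov hx)
    refine Set.mem_iUnion₂.2 ⟨θ, hθ, ?_⟩
    have h1 := hf.dist_le_mul x θ
    have h2 : (0:ℝ) < r θ := hr θ hθ
    rw [Metric.mem_closedBall] at hxθ
    rw [Metric.mem_ball]
    simp only [NNReal.coe_one, one_mul] at h1
    linarith
  obtain ⟨b, hbt, hbfin, hbcov⟩ :=
    hc.elim_finite_subcover_image (fun θ _ ↦ Metric.isOpen_ball) hopen
  refine ⟨hbfin.toFinset, fun θ ↦ 2 * r θ, fun θ hθ ↦ ?_, ?_, ?_⟩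
  · have hθt := hbt (hbfin.mem_toFinset.1 hθ)
    have h2 : (0:ℝ) < r θ := hr θ hθt
    exact ⟨by linarith, Set.mem_image_of_mem f (htT hθt)⟩
  · simpa using hbcov
  · have hpos : ∀ θ ∈ hbfin.toFinset, 0 ≤ 2 * r θ := fun θ hθ ↦ by
      have h2 : (0:ℝ) < r θ := hr θ (hbt (hbfin.mem_toFinset.1 hθ))
      linarith
    rw [← ENNReal.ofReal_le_ofReal_iff hη.le, ENNReal.ofReal_sum_of_nonneg hpos]
    rw [hT, zero_add] at hsum
    refine le_trans ?_ hsum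
    rw [tsum_subtype t (fun x ↦ volume (Metric.closedBall x (r x)))]
    refine le_trans (le_of_eq ?_) (ENNReal.sum_le_tsum hbfin.toFinset)
    refine Finset.sum_congr rfl fun θ hθ ↦ ?_
    rw [Set.indicator_of_mem (hbt (hbfin.mem_toFinset.1 hθ)), Real.volume_closedBall]

lemma norm_one_sub_mul_conj {ζ : ℂ} (hζ : ‖ζ‖ = 1) (z : ℂ) :
    ‖1 - z * (starRingEnd ℂ) ζ‖ = ‖z - ζ‖ := by
  have h : ζ * (starRingEnd ℂ) ζ = 1 := by simp [Complex.mul_conj', hζ]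
  rw [← h, ← sub_mul, norm_mul, RCLike.norm_conj, hζ, mul_one, norm_sub_rev]

lemma le_re_one_add_sub_mul_conj {ζ z : ℂ} (hζ : ‖ζ‖ = 1) (hz : ‖z‖ ≤ 1) (ℓ : ℝ) :
    ℓ ≤ (1 + ℓ - z * (starRingEnd ℂ) ζ).re := by
  have h : (z * (starRingEnd ℂ) ζ).re ≤ 1 := by
    refine (Complex.re_le_norm _).trans ?_
    rwa [norm_mul, RCLike.norm_conj, hζ, mul_one]
  simp only [Complex.sub_re, Complex.add_re, Complex.one_re, Complex.ofReal_re]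
  linarith

/-- A disc-algebra function with nonnegative real part which is large on a null compact subset `K`
of the circle and small away from a neighbourhood of `K`. -/
lemma exists_nonneg_re_large_on {K : Set ℂ} (hKc : IsCompact K)
    (hKs : K ⊆ Metric.sphere (0:ℂ) 1) (hK0 : arclength K = 0) {V : Set ℂ} (hV : IsOpen V)
    (hKV : K ⊆ V) {M δ : ℝ} (hM : 0 < M) (hδ : 0 < δ) :
    ∃ F : ℂ → ℂ, ContinuousOn F (Metric.closedBall (0:ℂ) 1) ∧
      DifferentiableOn ℂ F (Metric.ball (0:ℂ) 1) ∧
      (∀ z ∈ Metric.closedBall (0:ℂ) 1, 0 ≤ (F z).re) ∧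
      (∀ z ∈ K, M ≤ (F z).re) ∧
      (∀ z ∈ Metric.closedBall (0:ℂ) 1 \ V, ‖F z‖ ≤ δ) := by
  obtain ⟨d, hd, hdV⟩ := hKc.exists_thickening_subset_open hV hKV
  obtain ⟨T, hT, rfl⟩ := exists_volume_eq_zero_image_circleMap hKc hKs hK0
  have hη : 0 < min (d / 2) (δ * d / (8 * M)) := by positivity
  have hlip : LipschitzWith 1 (circleMap 0 1) := by
    simpa using lipschitzWith_circleMap 0 1
  obtain ⟨s, r, hs, hcov, hsum⟩ := exists_finset_ball_cover_sum_le hlip hT hKc hη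
  have hζ (θ : ℝ) : ‖circleMap 0 1 θ‖ = 1 := by simp
  let w (θ : ℝ) (z : ℂ) : ℂ := 1 + r θ - z * (starRingEnd ℂ) (circleMap 0 1 θ)
  have hwre {θ : ℝ} {z : ℂ} (hz : z ∈ Metric.closedBall (0:ℂ) 1) : r θ ≤ (w θ z).re :=
    le_re_one_add_sub_mul_conj (hζ θ) (mem_closedBall_zero_iff.1 hz) _
  have hw0 {θ : ℝ} (hθ : θ ∈ s) {z : ℂ} (hz : z ∈ Metric.closedBall (0:ℂ) 1) : w θ z ≠ 0 := by
    intro h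
    have h1 := hwre (θ := θ) hz
    rw [h, Complex.zero_re] at h1
    exact (hs θ hθ).1.not_ge h1
  have hre (θ : ℝ) (z : ℂ) : (((4 * M * r θ : ℝ) : ℂ) / w θ z).re =
      4 * M * r θ * (w θ z).re / Complex.normSq (w θ z) := by
    rw [div_eq_mul_inv, Complex.re_ofReal_mul, Complex.inv_re, mul_div_assoc]
  have hterm {θ : ℝ} (hθ : θ ∈ s) {z : ℂ} (hz : z ∈ Metric.closedBall (0:ℂ) 1) :
      0 ≤ (((4 * M * r θ : ℝ) : ℂ) / w θ z).re := by
    rw [hre]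
    have h1 := (hs θ hθ).1
    have h2 := h1.le.trans (hwre (θ := θ) hz)
    have h3 := Complex.normSq_nonneg (w θ z)
    positivity
  have hdiff : DifferentiableOn ℂ (fun z ↦ ∑ θ ∈ s, ((4 * M * r θ : ℝ) : ℂ) / w θ z)
      (Metric.closedBall (0:ℂ) 1) := by
    refine DifferentiableOn.fun_sum fun θ hθ ↦ ?_
    refine DifferentiableOn.div (differentiableOn_const _) ?_ fun z hz ↦ hw0 hθ hz
    fun_prop
  refine ⟨_, hdiff.continuousOn, hdiff.mono Metric.ball_subset_closedBall, fun z hz ↦ ?_,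
    fun z hz ↦ ?_, fun z hz ↦ ?_⟩
  · rw [Complex.re_sum]
    exact Finset.sum_nonneg fun θ hθ ↦ hterm hθ hz
  · have hzc : z ∈ Metric.closedBall (0:ℂ) 1 := Metric.sphere_subset_closedBall (hKs hz)
    obtain ⟨θ, hθ, hzθ⟩ := Set.mem_iUnion₂.1 (hcov hz)
    rw [Complex.re_sum]
    refine le_trans ?_ (Finset.single_le_sum (fun θ hθ ↦ hterm hθ hzc) hθ)
    have hr := (hs θ hθ).1
    have hwr := hwre (θ := θ) hzc
    have hwn : ‖w θ z‖ ≤ 2 * r θ := by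
      have h1 : w θ z = r θ + (1 - z * (starRingEnd ℂ) (circleMap 0 1 θ)) := by
        simp only [w]; ring
      rw [h1]
      refine (norm_add_le _ _).trans ?_
      rw [norm_one_sub_mul_conj (hζ θ), Complex.norm_real, Real.norm_of_nonneg hr.le]
      rw [Metric.mem_ball, dist_eq_norm] at hzθ
      linarith
    rw [hre, le_div_iff₀ (Complex.normSq_pos.2 (hw0 hθ hzc)), Complex.normSq_eq_norm_sq]
    have h2 : ‖w θ z‖ ^ 2 ≤ (2 * r θ) ^ 2 := by gcongr
    calc M * ‖w θ z‖ ^ 2 ≤ M * (2 * r θ) ^ 2 := by gcongr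
      _ = 4 * M * r θ * r θ := by ring
      _ ≤ 4 * M * r θ * (w θ z).re := by gcongr
  · have hbound : ∀ θ ∈ s, ‖((4 * M * r θ : ℝ) : ℂ) / w θ z‖ ≤ 8 * M / d * r θ := by
      intro θ hθ
      have hr := (hs θ hθ).1
      have hrd : r θ ≤ d / 2 :=
        ((Finset.single_le_sum (f := r) (fun θ hθ ↦ (hs θ hθ).1.le) hθ).trans hsum).trans
          (min_le_left _ _)
      have hdist : d ≤ ‖z - circleMap 0 1 θ‖ := by
        by_contra! h
        rw [← dist_eq_norm] at h
        exact hz.2 (hdV (Metric.mem_thickening_iff.2 ⟨_, (hs θ hθ).2, h⟩))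
      have hwn : d / 2 ≤ ‖w θ z‖ := by
        have h1 : 1 - z * (starRingEnd ℂ) (circleMap 0 1 θ) = w θ z - r θ := by
          simp only [w]; ring
        have h2 := norm_sub_le (w θ z) (r θ : ℂ)
        rw [← h1, norm_one_sub_mul_conj (hζ θ), Complex.norm_real,
          Real.norm_of_nonneg hr.le] at h2
        linarith
      rw [norm_div, Complex.norm_real, Real.norm_of_nonneg (by positivity)]
      calc 4 * M * r θ / ‖w θ z‖ ≤ 4 * M * r θ / (d / 2) := by gcongr
        _ = 8 * M / d * r θ := by field_simp; ring
    refine (norm_sum_le_of_le s hbound).trans ?_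
    rw [← Finset.mul_sum]
    calc 8 * M / d * ∑ θ ∈ s, r θ ≤ 8 * M / d * (δ * d / (8 * M)) := by
          gcongr
          exact hsum.trans (min_le_right _ _)
      _ = δ := by field_simp

/-- The disc-algebra approximation of a constant `c` on `K` and of `1` away from `K`. -/
lemma exists_approx_const {K : Set ℂ} (hKc : IsCompact K)
    (hKs : K ⊆ Metric.sphere (0:ℂ) 1) (hK0 : arclength K = 0) {V : Set ℂ} (hV : IsOpen V)
    (hKV : K ⊆ V) {c : ℂ} (hc : ‖c‖ ≤ 1) {ε : ℝ} (hε : 0 < ε) :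
    ∃ g : ℂ → ℂ, ContinuousOn g (Metric.closedBall (0:ℂ) 1) ∧
      DifferentiableOn ℂ g (Metric.ball (0:ℂ) 1) ∧
      (∀ z ∈ Metric.closedBall (0:ℂ) 1, ‖g z‖ ≤ 1) ∧
      (∀ z ∈ K, ‖g z - c‖ ≤ ε) ∧
      (∀ z ∈ Metric.closedBall (0:ℂ) 1 \ V, ‖g z - 1‖ ≤ ε) := by
  by_cases hc1 : c = 1
  · subst hc1
    exact ⟨fun _ ↦ 1, continuousOn_const, differentiableOn_const _, by simp,
      by simp [hε.le], by simp [hε.le]⟩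
  have hcre : 0 < (1 - c).re := by
    rw [Complex.sub_re, Complex.one_re, sub_pos]
    by_contra! h
    have h1 := Complex.sq_norm c
    rw [Complex.normSq_apply] at h1
    have h2 : ‖c‖ ^ 2 ≤ 1 := pow_le_one₀ (norm_nonneg _) hc
    have hre : c.re = 1 := by nlinarith [mul_self_nonneg c.im]
    have him : c.im = 0 := by
      rw [hre] at h1
      exact mul_self_eq_zero.1 (le_antisymm (by linarith) (mul_self_nonneg _))
    exact hc1 (Complex.ext hre him)
  have hnc : ‖1 - c‖ ≤ 2 := (norm_sub_le _ _).trans (by rw [norm_one]; linarith)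
  obtain ⟨F, hFc, hFd, hF0, hFM, hFδ⟩ := exists_nonneg_re_large_on hKc hKs hK0 hV hKV
    (M := 4 / ε) (δ := ε * (1 - c).re / 2) (by positivity) (by positivity)
  have hden {z : ℂ} (hz : z ∈ Metric.closedBall (0:ℂ) 1) :
      (1 - c).re + (F z).re ≤ ‖1 - c + F z‖ := by
    rw [← Complex.add_re]
    exact Complex.re_le_norm _
  have hpos {z : ℂ} (hz : z ∈ Metric.closedBall (0:ℂ) 1) : 0 < ‖1 - c + F z‖ := by
    linarith [hden hz, hF0 z hz]
  have hne {z : ℂ} (hz : z ∈ Metric.closedBall (0:ℂ) 1) : 1 - c + F z ≠ 0 :=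
    norm_pos_iff.1 (hpos hz)
  refine ⟨fun z ↦ (1 - c + c * F z) / (1 - c + F z), ?_, ?_, fun z hz ↦ ?_, fun z hz ↦ ?_,
    fun z hz ↦ ?_⟩
  · exact (continuousOn_const.add (continuousOn_const.mul hFc)).div
      (continuousOn_const.add hFc) fun z hz ↦ hne hz
  · exact ((hFd.const_mul c).const_add (1 - c)).div (hFd.const_add (1 - c))
      fun z hz ↦ hne (Metric.ball_subset_closedBall hz)
  · rw [norm_div, div_le_one (hpos hz)]
    refine le_of_sq_le_sq ?_ (norm_nonneg _)
    have h1 := Complex.sq_norm c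
    rw [Complex.normSq_apply] at h1
    have h2 : ‖c‖ ^ 2 ≤ 1 := pow_le_one₀ (norm_nonneg _) hc
    have hF := hF0 z hz
    rw [Complex.sq_norm, Complex.sq_norm, Complex.normSq_apply, Complex.normSq_apply]
    simp only [Complex.add_re, Complex.add_im, Complex.sub_re, Complex.sub_im, Complex.mul_re,
      Complex.mul_im, Complex.one_re, Complex.one_im]
    nlinarith [mul_nonneg (sub_nonneg.2 h2) (add_nonneg (mul_self_nonneg (F z).re)
      (mul_self_nonneg (F z).im)), mul_nonneg hF (add_nonneg (mul_self_nonneg (1 - c.re))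
      (mul_self_nonneg c.im))]
  · have hzc : z ∈ Metric.closedBall (0:ℂ) 1 := Metric.sphere_subset_closedBall (hKs hz)
    have h : (1 - c + c * F z) / (1 - c + F z) - c = (1 - c) ^ 2 / (1 - c + F z) := by
      rw [div_sub' (hne hzc)]; ring
    have hM : 4 / ε ≤ ‖1 - c + F z‖ := by linarith [hden hzc, hFM z hz]
    rw [h, norm_div, norm_pow, div_le_iff₀ (hpos hzc)]
    rw [div_le_iff₀ hε] at hM
    nlinarith [norm_nonneg (1 - c)]
  · have h : (1 - c + c * F z) / (1 - c + F z) - 1 = -((1 - c) * F z / (1 - c + F z)) := by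
      rw [div_sub' (hne hz.1)]; ring
    rw [h, norm_neg, norm_div, norm_mul, div_le_iff₀ (hpos hz.1)]
    calc ‖1 - c‖ * ‖F z‖ ≤ 2 * (ε * (1 - c).re / 2) := by
          gcongr
          exact hFδ z hz
      _ = ε * (1 - c).re := by ring
      _ ≤ ε * ‖1 - c + F z‖ := by
          gcongr
          linarith [hden hz.1, hF0 z hz.1]

lemma norm_prod_sub_prod_le_sum {ι R : Type*} [NormedCommRing R] [NormOneClass R] (s : Finset ι)
    {f g : ι → R} (hf : ∀ i ∈ s, ‖f i‖ ≤ 1) (hg : ∀ i ∈ s, ‖g i‖ ≤ 1) :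
    ‖∏ i ∈ s, f i - ∏ i ∈ s, g i‖ ≤ ∑ i ∈ s, ‖f i - g i‖ := by
  classical
  induction s using Finset.induction_on with
  | empty => simp
  | insert a s ha ih =>
    rw [Finset.prod_insert ha, Finset.prod_insert ha, Finset.sum_insert ha]
    have hfs : ∀ i ∈ s, ‖f i‖ ≤ 1 := fun i hi ↦ hf i (Finset.mem_insert_of_mem hi)
    have hgs : ∀ i ∈ s, ‖g i‖ ≤ 1 := fun i hi ↦ hg i (Finset.mem_insert_of_mem hi)
    have hprod : ‖∏ i ∈ s, f i‖ ≤ 1 :=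
      (Finset.norm_prod_le s f).trans (Finset.prod_le_one (fun _ _ ↦ norm_nonneg _) hfs)
    have hga := hg a (Finset.mem_insert_self a s)
    calc ‖f a * ∏ i ∈ s, f i - g a * ∏ i ∈ s, g i‖
        = ‖(f a - g a) * ∏ i ∈ s, f i + g a * (∏ i ∈ s, f i - ∏ i ∈ s, g i)‖ := by
          congr 1; ring
      _ ≤ ‖f a - g a‖ * ‖∏ i ∈ s, f i‖ + ‖g a‖ * ‖∏ i ∈ s, f i - ∏ i ∈ s, g i‖ :=
          (norm_add_le _ _).trans (add_le_add (norm_mul_le _ _) (norm_mul_le _ _))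
      _ ≤ ‖f a - g a‖ * 1 + 1 * ∑ i ∈ s, ‖f i - g i‖ := by
          gcongr
          exact ih hfs hgs
      _ = _ := by ring

/-- A continuous function on a totally disconnected compact set is uniformly close to a function
which is constant on the pieces of a finite partition into compact sets. -/
lemma exists_finite_compact_partition {X : Type*} [TopologicalSpace X] [T2Space X] {K : Set X}
    (hKc : IsCompact K) (hK : IsTotallyDisconnected K) {φ : X → ℂ} (hφc : ContinuousOn φ K)
    (hφ1 : ∀ z ∈ K, ‖φ z‖ ≤ 1) {ε : ℝ} (hε : 0 < ε) :
    ∃ (n : ℕ) (P : Fin n → Set X) (c : Fin n → ℂ), (∀ i, IsCompact (P i)) ∧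
      (∀ i, ‖c i‖ ≤ 1) ∧ (⋃ i, P i) = K ∧ (∀ i j, i ≠ j → Disjoint (P i) (P j)) ∧
      ∀ i, ∀ z ∈ P i, ‖φ z - c i‖ < ε := by
  have : CompactSpace K := isCompact_iff_compactSpace.1 hKc
  have : TotallyDisconnectedSpace K := totallyDisconnectedSpace_subtype_iff.2 hK
  let f : C(K, Metric.closedBall (0:ℂ) 1) :=
    ⟨fun z ↦ ⟨φ z, mem_closedBall_zero_iff.2 (hφ1 z z.2)⟩,
      Continuous.subtype_mk (continuousOn_iff_continuous_domRestrict.1 hφc) _⟩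
  have hS : {p : Metric.closedBall (0:ℂ) 1 × Metric.closedBall (0:ℂ) 1 | dist p.1 p.2 < ε} ∈
      nhdsSet (Set.diagonal (Metric.closedBall (0:ℂ) 1)) := by
    refine (isOpen_lt continuous_dist continuous_const).mem_nhdsSet.2 ?_
    rintro ⟨x, y⟩ (rfl : x = y)
    simpa using hε
  obtain ⟨n, g, h, hg, hgh⟩ := f.exists_finite_approximation_of_mem_nhds_diagonal hS
  refine ⟨n, fun i ↦ Subtype.val '' (g ⁻¹' {i}), fun i ↦ h i, fun i ↦ ?_, fun i ↦ ?_, ?_,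
    fun i j hij ↦ ?_, ?_⟩
  · exact ((isClosed_discrete {i}).preimage hg).isCompact.image continuous_subtype_val
  · exact mem_closedBall_zero_iff.1 (h i).2
  · rw [← Set.image_iUnion, ← Set.preimage_iUnion, Set.iUnion_of_singleton, Set.preimage_univ,
      Set.image_univ, Subtype.range_coe]
  · refine Set.disjoint_image_of_injective Subtype.val_injective ?_
    exact Disjoint.preimage g (Set.disjoint_singleton.2 hij)
  · rintro i _ ⟨x, rfl, rfl⟩
    have := hgh x
    rwa [Set.mem_ofPred_eq, Subtype.dist_eq, dist_eq_norm] at this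

/-- A norm-one disc-algebra function approximating `φ` on `K` and close to 1 away from a
neighbourhood `U` of `K`. -/
theorem discAlgebra_approx_one (K : Set ℂ) (hKc : IsCompact K)
    (hKs : K ⊆ Metric.sphere (0:ℂ) 1) (hK0 : arclength K = 0)
    (φ : ℂ → ℂ) (hφc : ContinuousOn φ K) (hφ1 : ∀ z ∈ K, ‖φ z‖ ≤ 1)
    (U : Set ℂ) (hU : IsOpen U) (hKU : K ⊆ U) (ε : ℝ) (hε : 0 < ε) :
    ∃ g : ℂ → ℂ, ContinuousOn g (Metric.closedBall (0:ℂ) 1) ∧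
      DifferentiableOn ℂ g (Metric.ball (0:ℂ) 1) ∧
      (∀ z ∈ Metric.closedBall (0:ℂ) 1, ‖g z‖ ≤ 1) ∧
      (∀ z ∈ K, ‖g z - φ z‖ < ε) ∧
      (∀ z ∈ Metric.closedBall (0:ℂ) 1 \ U, ‖g z - 1‖ < ε) := by
  have hK : IsTotallyDisconnected K := by
    obtain ⟨T, hT, rfl⟩ := exists_volume_eq_zero_image_circleMap hKc hKs hK0
    exact isTotallyDisconnected_image_of_volume_eq_zero (lipschitzWith_circleMap 0 1) hT
  obtain ⟨n, P, c, hPc, hc, hPK, hPd, hφ⟩ :=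
    exists_finite_compact_partition hKc hK hφc hφ1 (half_pos hε)
  have hPsub (i) : P i ⊆ K := hPK ▸ Set.subset_iUnion P i
  let V (i : Fin n) : Set ℂ := U ∩ ⋂ j ∈ {j | j ≠ i}, (P j)ᶜ
  have hV (i) : IsOpen (V i) :=
    hU.inter ((Set.toFinite _).isOpen_biInter fun j _ ↦ (hPc j).isClosed.isOpen_compl)
  have hPV (i) : P i ⊆ V i := fun z hz ↦ ⟨hKU (hPsub i hz),
    Set.mem_iInter₂.2 fun j hj ↦ (hPd i j (Ne.symm hj)).notMem_of_mem_left hz⟩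
  have hε' : 0 < ε / (2 * (n + 1)) := by positivity
  choose g hgc hgd hg1 hgP hgV using fun i ↦ exists_approx_const (hPc i)
    ((hPsub i).trans hKs) (measure_mono_null (hPsub i) hK0) (hV i) (hPV i) (hc i) hε'
  have hsum {a : Fin n → ℝ} (ha : ∀ i, a i ≤ ε / (2 * (n + 1))) : ∑ i, a i < ε / 2 := by
    calc ∑ i, a i ≤ ∑ _i : Fin n, ε / (2 * (n + 1)) := Finset.sum_le_sum fun i _ ↦ ha i
      _ = n * (ε / (2 * (n + 1))) := by simp
      _ < (n + 1) * (ε / (2 * (n + 1))) := by gcongr; linarith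
      _ = ε / 2 := by field_simp
  refine ⟨fun z ↦ ∏ i, g i z, continuousOn_finsetProd _ fun i _ ↦ hgc i,
    DifferentiableOn.fun_finsetProd fun i _ ↦ hgd i, fun z hz ↦ ?_, fun z hz ↦ ?_, fun z hz ↦ ?_⟩
  · rw [norm_prod]
    exact Finset.prod_le_one (fun _ _ ↦ norm_nonneg _) fun i _ ↦ hg1 i z hz
  · have hzc : z ∈ Metric.closedBall (0:ℂ) 1 := Metric.sphere_subset_closedBall (hKs hz)
    rw [← hPK] at hz
    obtain ⟨i, hi⟩ := Set.mem_iUnion.1 hz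
    have hprod : ∏ j, (if j = i then c i else 1) = c i := by simp
    have h1 : ‖∏ j, g j z - c i‖ < ε / 2 := by
      rw [← hprod]
      refine (norm_prod_sub_prod_le_sum _ (fun j _ ↦ hg1 j z hzc) fun j _ ↦ ?_).trans_lt
        (hsum fun j ↦ ?_)
      · split_ifs
        · exact hc i
        · simp
      · split_ifs with hji
        · subst hji
          exact hgP j z hi
        · refine hgV j z ⟨hzc, fun hzV ↦ ?_⟩
          exact Set.mem_iInter₂.1 hzV.2 i (Ne.symm hji) hi
    calc ‖∏ j, g j z - φ z‖ ≤ ‖∏ j, g j z - c i‖ + ‖c i - φ z‖ :=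
          norm_sub_le_norm_sub_add_norm_sub _ _ _
      _ < ε / 2 + ε / 2 := add_lt_add h1 (by rw [norm_sub_rev]; exact hφ i z hi)
      _ = ε := add_halves ε
  · have h1 : ‖∏ j, g j z - ∏ _j : Fin n, (1:ℂ)‖ < ε / 2 := by
      refine (norm_prod_sub_prod_le_sum _ (fun j _ ↦ hg1 j z hz.1) (by simp)).trans_lt
        (hsum fun j ↦ hgV j z ⟨hz.1, fun hzV ↦ hz.2 hzV.1⟩)
    rw [Finset.prod_const_one] at h1
    linarith
end
end
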